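/- Let n, k ∈ ℕ with 0 < k < n, and let e : {1,…,n} → ℝ satisfy 0 ≤ e_i ≤ k/n for all i. Set e_max = max_i e_i. Then p_E(n,k) ≤ p(n,k,e_max), i.e. the Poisson binomial probability of exactly k errors is at most the binomial probability C(n,k) · e_max^k · (1 − e_max)^{n−k}. -/

import Mathlib

/-- Poisson binomial probability: the probability that exactly `k` of the
classifiers indexed by `S` make an error, where classifier `i` errs with
probability `e i`. -/
noncomputable def pE (S : Finset ℕ) (e : ℕ → ℝ) (k : ℕ) : ℝ :=
  ∑ A ∈ S.powerset.filter (fun A => A.card = k),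
    (∏ i ∈ A, e i) * ∏ j ∈ S \ A, (1 - e j)

/-- Binomial probability `C(N,k) ē^k (1-ē)^(N-k)`. -/
noncomputable def pBin (N k : ℕ) (eb : ℝ) : ℝ :=
  (N.choose k : ℝ) * eb ^ k * (1 - eb) ^ (N - k)

open Polynomial in
/-- The Poisson binomial probabilities are the coefficients of their generating polynomial. -/
theorem pE_eq_coeff (S : Finset ℕ) (e : ℕ → ℝ) (k : ℕ) :
    pE S e k = (∏ i ∈ S, (C (e i) * X + C (1 - e i))).coeff k := by
  rw [Finset.prod_add, finsetSum_coeff, pE, Finset.sum_filter]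
  refine Finset.sum_congr rfl fun A _ => ?_
  rw [Finset.prod_mul_distrib, Finset.prod_const, ← map_prod, ← map_prod, mul_right_comm,
    ← C_mul, coeff_C_mul, coeff_X_pow]
  split_ifs <;> simp_all

theorem pE_nonneg {S : Finset ℕ} {e : ℕ → ℝ} (h : ∀ i ∈ S, 0 ≤ e i ∧ e i ≤ 1) (k : ℕ) :
    0 ≤ pE S e k := by
  refine Finset.sum_nonneg fun A hA => mul_nonneg ?_ ?_
  · rw [Finset.mem_filter, Finset.mem_powerset] at hA
    exact Finset.prod_nonneg fun i hi => (h i (hA.1 hi)).1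
  · exact Finset.prod_nonneg fun i hi => sub_nonneg.2 (h i (Finset.mem_sdiff.1 hi).1).2

theorem pE_congr {S : Finset ℕ} {e e' : ℕ → ℝ} (h : ∀ i ∈ S, e i = e' i) (k : ℕ) :
    pE S e k = pE S e' k := by
  rw [pE_eq_coeff, pE_eq_coeff, Finset.prod_congr rfl fun i hi => by rw [h i hi]]

open Polynomial in
theorem pE_succ_eq_erase {S : Finset ℕ} {a : ℕ} (ha : a ∈ S) (e : ℕ → ℝ) (k : ℕ) :
    pE S e (k + 1) = e a * pE (S.erase a) e k + (1 - e a) * pE (S.erase a) e (k + 1) := by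
  rw [pE_eq_coeff, pE_eq_coeff, pE_eq_coeff, ← Finset.mul_prod_erase S _ ha, add_mul, coeff_add,
    mul_assoc, coeff_C_mul, coeff_X_mul, coeff_C_mul]

open Polynomial in
theorem succ_mul_pE_succ (S : Finset ℕ) (e : ℕ → ℝ) (k : ℕ) :
    ((k : ℝ) + 1) * pE S e (k + 1) = ∑ j ∈ S, e j * pE (S.erase j) e k := by
  have h := congrArg (coeff · k)
    (derivative_prod_finset (s := S) (f := fun i => C (e i) * X + C (1 - e i)))
  simp only [coeff_derivative, finsetSum_coeff, derivative_add, derivative_C_mul, derivative_X,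
    derivative_C, mul_one, add_zero, coeff_mul_C, ← pE_eq_coeff] at h
  rw [mul_comm, h]
  exact Finset.sum_congr rfl fun j _ => mul_comm _ _

theorem sub_mul_pE (S : Finset ℕ) (e : ℕ → ℝ) (k : ℕ) :
    ((S.card : ℝ) - k) * pE S e k = ∑ j ∈ S, (1 - e j) * pE (S.erase j) e k := by
  cases k with
  | zero =>
    have h (j) (hj : j ∈ S) : (1 - e j) * pE (S.erase j) e 0 = pE S e 0 := by
      rw [pE_eq_coeff, pE_eq_coeff, ← Finset.mul_prod_erase S _ hj, Polynomial.mul_coeff_zero]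
      simp
    rw [Finset.sum_congr rfl h]
    simp
  | succ k =>
    have h (j) (hj : j ∈ S) : (1 - e j) * pE (S.erase j) e (k + 1)
        = pE S e (k + 1) - e j * pE (S.erase j) e k := by
      rw [pE_succ_eq_erase hj]
      ring
    rw [Finset.sum_congr rfl h, Finset.sum_sub_distrib, ← succ_mul_pE_succ, Finset.sum_const,
      nsmul_eq_mul]
    push_cast
    ring

/-- If no error probability exceeds `(k + 1) / (|S| + 1)`, then `k + 1` errors are at most as
likely as `k` errors. -/
theorem pE_succ_le {S : Finset ℕ} {e : ℕ → ℝ} {k : ℕ} (hk : k < S.card)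
    (h : ∀ i ∈ S, 0 ≤ e i ∧ e i ≤ ((k : ℝ) + 1) / (S.card + 1)) :
    pE S e (k + 1) ≤ pE S e k := by
  have hkS : (k : ℝ) < S.card := by exact_mod_cast hk
  have h1 : ((k : ℝ) + 1) / (S.card + 1) ≤ 1 := by
    rw [div_le_one (by positivity)]
    linarith
  have key : ((S.card : ℝ) - k) * (∑ j ∈ S, e j * pE (S.erase j) e k)
      ≤ ((k : ℝ) + 1) * ∑ j ∈ S, (1 - e j) * pE (S.erase j) e k := by
    rw [Finset.mul_sum, Finset.mul_sum]
    refine Finset.sum_le_sum fun j hj => ?_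
    rw [← mul_assoc, ← mul_assoc]
    refine mul_le_mul_of_nonneg_right ?_ (pE_nonneg (fun i hi => ?_) k)
    · have := (le_div_iff₀ (by positivity)).1 (h j hj).2
      linarith
    · have := h i (Finset.mem_of_mem_erase hi)
      exact ⟨this.1, this.2.trans h1⟩
  rw [← succ_mul_pE_succ, ← sub_mul_pE] at key
  refine le_of_mul_le_mul_left (a := ((S.card : ℝ) - k) * (k + 1)) ?_
    (mul_pos (sub_pos.2 hkS) (by positivity))
  linarith

/-- Raising one error probability raises the probability of `k + 1` errors, as long as the others
are at most `(k + 1) / |S|`. -/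
theorem pE_succ_le_of_eq_off {S : Finset ℕ} {a k : ℕ} {e e' : ℕ → ℝ} (ha : a ∈ S)
    (hk : k + 1 < S.card) (h : ∀ i ∈ S, 0 ≤ e i ∧ e i ≤ ((k : ℝ) + 1) / S.card)
    (heq : ∀ i ∈ S, i ≠ a → e i = e' i) (hle : e a ≤ e' a) :
    pE S e (k + 1) ≤ pE S e' (k + 1) := by
  have hcard := Finset.card_erase_add_one ha
  have hdec : pE (S.erase a) e (k + 1) ≤ pE (S.erase a) e k := by
    refine pE_succ_le (by omega) fun i hi => ?_
    rw [← Nat.cast_add_one (S.erase a).card, hcard]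
    exact h i (Finset.mem_of_mem_erase hi)
  have heq' (i) (hi : i ∈ S.erase a) : e' i = e i :=
    (heq i (Finset.mem_of_mem_erase hi) (Finset.ne_of_mem_erase hi)).symm
  rw [pE_succ_eq_erase ha, pE_succ_eq_erase ha, pE_congr heq', pE_congr heq']
  nlinarith [mul_nonneg (sub_nonneg.2 hle) (sub_nonneg.2 hdec)]

theorem pE_const (S : Finset ℕ) (c : ℝ) (k : ℕ) : pE S (fun _ => c) k = pBin S.card k c := by
  rw [pE, pBin, ← Finset.powersetCard_eq_filter, mul_assoc, ← Finset.card_powersetCard,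
    ← nsmul_eq_mul]
  refine Finset.sum_eq_card_nsmul fun A hA => ?_
  rw [Finset.mem_powersetCard] at hA
  rw [Finset.prod_const, Finset.prod_const, Finset.card_sdiff_of_subset hA.1, hA.2]

theorem pE_succ_le_pBin {S : Finset ℕ} {k : ℕ} (hk : k + 1 < S.card) {e : ℕ → ℝ} {c : ℝ}
    (h0 : ∀ i ∈ S, 0 ≤ e i) (hub : ∀ i ∈ S, e i ≤ c) (hc : c ≤ ((k : ℝ) + 1) / S.card) :
    pE S e (k + 1) ≤ pBin S.card (k + 1) c := by
  have key : ∀ T ⊆ S, pE S e (k + 1) ≤ pE S (fun i => if i ∈ T then c else e i) (k + 1) := by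
    intro T
    induction T using Finset.induction_on with
    | empty => simp
    | insert a T haT ih =>
      intro hT
      have ha : a ∈ S := hT (Finset.mem_insert_self a T)
      refine (ih ((Finset.subset_insert a T).trans hT)).trans
        (pE_succ_le_of_eq_off ha hk (fun i hi => ?_) (fun i _ hia => ?_) ?_)
      · split_ifs
        · exact ⟨(h0 i hi).trans (hub i hi), hc⟩
        · exact ⟨h0 i hi, (hub i hi).trans hc⟩
      · simp [hia]
      · simpa [haT] using hub a ha
  refine (key S subset_rfl).trans_eq ?_
  rw [← pE_const]
  exact pE_congr (fun i hi => if_pos hi) _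

theorem stmt3 (n k : ℕ) (hk : 0 < k) (hkn : k < n)
    (e : ℕ → ℝ) (he : ∀ i ∈ Finset.Icc 1 n, 0 ≤ e i ∧ e i ≤ (k : ℝ) / n)
    (emax : ℝ) (hub : ∀ i ∈ Finset.Icc 1 n, e i ≤ emax)
    (hmem : ∃ i ∈ Finset.Icc 1 n, e i = emax) :
    pE (Finset.Icc 1 n) e k ≤ pBin n k emax := by
  obtain ⟨k, rfl⟩ := Nat.exists_eq_succ_of_ne_zero hk.ne'
  obtain ⟨a, ha, rfl⟩ := hmem
  have h := pE_succ_le_pBin (S := Finset.Icc 1 n) (k := k) (by simpa using hkn)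
    (fun i hi => (he i hi).1) hub (by simpa using (he a ha).2)
  simpa using h
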